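/- Let $k > 0$ and let $\ell \colon \mathbb{R} \times \mathbb{R} \to \mathbb{C}$ be continuously differentiable and $2\pi$-periodic in each of its two variables. Then there exists a constant $C > 0$ (depending only on $k$ and $\ell$) such that for every $R \ge 1$ and every continuously differentiable $2\pi$-periodic function $\varphi \colon \mathbb{R} \to \mathbb{C}$, $\left( \int_0^{2\pi} \left| \int_0^{2\pi} e^{2 i k R \cos(\theta - s)}\, \ell(\theta, s)\, \varphi(s)\, ds \right|^2 d\theta \right)^{1/2} \le \frac{C}{R^{1/2}} \left( \int_0^{2\pi} \left( |\varphi(s)|^2 + |\varphi'(s)|^2 \right) ds \right)^{1/2}$. -/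

import Mathlib

open MeasureTheory intervalIntegral Real

lemma integral_inv_sq_add_sin_sq_le (a : ℝ) (ha : 0 < a) (θ : ℝ) :
    ∫ s in (0:ℝ)..(2 * π), 1 / (a ^ 2 + sin (s - θ) ^ 2) ≤ 4 * π / a := by
  set f : ℝ → ℝ := fun s => 1 / (a ^ 2 + sin s ^ 2) with hf
  have hpos : ∀ s, 0 < a ^ 2 + sin s ^ 2 := fun s => by positivity
  have hc : Continuous f := by
    refine continuous_const.div (by fun_prop) fun s => (hpos s).ne'
  have hper : Function.Periodic f π := fun s => by simp [hf, sin_add_pi]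
  have hper' : Function.Periodic f (2 * π) := fun s => by simp [hf]
  have hshift : ∫ s in (0:ℝ)..(2 * π), f (s - θ) = ∫ s in (-(π / 2))..(-(π / 2) + 2 * π), f s := by
    rw [intervalIntegral.integral_comp_sub_right f θ]
    have := hper'.intervalIntegral_add_eq (0 - θ) (-(π / 2))
    rw [← this]
    congr 1
    ring
  have hhalf : ∫ s in (-(π / 2))..(π / 2), f s ≤ 2 * π / a := by
    have hle : ∀ s ∈ Set.Icc (-(π / 2)) (π / 2), f s ≤ 1 / (a ^ 2 + s ^ 2 / 4) := by
      intro s hs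
      have h1 : |s| ≤ π / 2 := abs_le.2 hs
      have h2 := mul_abs_le_abs_sin h1
      have h3 : |s| / 2 ≤ |sin s| := by
        refine le_trans ?_ h2
        have : 1 / 2 ≤ 2 / π := by
          rw [div_le_div_iff₀ two_pos pi_pos]; linarith [pi_le_four]
        nlinarith [abs_nonneg s]
      have h4 : s ^ 2 / 4 ≤ sin s ^ 2 := by
        rw [← sq_abs s, ← sq_abs (sin s)]
        nlinarith [abs_nonneg s]
      exact one_div_le_one_div_of_le (by positivity) (by linarith)
    have hc2 : Continuous fun s : ℝ => 1 / (a ^ 2 + s ^ 2 / 4) :=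
      continuous_const.div (by fun_prop) fun s => by positivity
    have hderiv : ∀ s ∈ Set.uIcc (-(π / 2)) (π / 2),
        HasDerivAt (fun s => 2 / a * arctan (s / (2 * a))) (1 / (a ^ 2 + s ^ 2 / 4)) s := by
      intro s _
      refine ((((hasDerivAt_id' s).div_const (2 * a)).arctan).const_mul (2 / a)).congr_deriv ?_
      field_simp
      ring
    calc ∫ s in (-(π / 2))..(π / 2), f s
        ≤ ∫ s in (-(π / 2))..(π / 2), 1 / (a ^ 2 + s ^ 2 / 4) :=
          intervalIntegral.integral_mono_on (by linarith [pi_pos]) (hc.intervalIntegrable _ _)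
            (hc2.intervalIntegrable _ _) hle
      _ = 2 / a * arctan (π / 2 / (2 * a)) - 2 / a * arctan (-(π / 2) / (2 * a)) :=
          intervalIntegral.integral_eq_sub_of_hasDerivAt hderiv (hc2.intervalIntegrable _ _)
      _ ≤ 2 / a * (π / 2) - 2 / a * (-(π / 2)) := by
          have h1 := (arctan_lt_pi_div_two (π / 2 / (2 * a))).le
          have h2 := (neg_pi_div_two_lt_arctan (-(π / 2) / (2 * a))).le
          gcongr
      _ = 2 * π / a := by ring
  have hsecond : ∫ s in (π / 2)..(-(π / 2) + 2 * π), f s = ∫ s in (-(π / 2))..(π / 2), f s := by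
    have := hper.intervalIntegral_add_eq (π / 2) (-(π / 2))
    convert this using 2 <;> ring
  change ∫ s in (0:ℝ)..(2 * π), f (s - θ) ≤ _
  rw [hshift, ← intervalIntegral.integral_add_adjacent_intervals
    (hc.intervalIntegrable _ (π / 2)) (hc.intervalIntegrable _ _), hsecond]
  calc _ ≤ 2 * π / a + 2 * π / a := add_le_add hhalf hhalf
    _ = 4 * π / a := by ring

lemma hasDerivAt_sin_sub_div (a : ℝ) (ha : 0 < a) (θ s : ℝ) :
    HasDerivAt (fun s => sin (s - θ) / (a ^ 2 + sin (s - θ) ^ 2))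
      (cos (s - θ) * (a ^ 2 - sin (s - θ) ^ 2) / (a ^ 2 + sin (s - θ) ^ 2) ^ 2) s := by
  have h1 : HasDerivAt (fun s => sin (s - θ)) (cos (s - θ)) s := by
    simpa using ((hasDerivAt_id s).sub_const θ).sin
  have hp : a ^ 2 + sin (s - θ) ^ 2 ≠ 0 := by positivity
  refine (h1.div ((h1.fun_pow 2).const_add (a ^ 2)) hp).congr_deriv ?_
  congr 1
  push_cast
  ring

/-- Quantitative stationary phase bound for the phase `cos (θ - s)` over one period, for an
amplitude taking equal values at both ends; `a` is the width of the stationary region. -/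
lemma norm_integral_exp_cos_mul_le (c a : ℝ) (hc : 0 < c) (ha : 0 < a) (θ B : ℝ)
    (g g' : ℝ → ℂ) (hg : ∀ s, HasDerivAt g (g' s) s) (hg' : Continuous g')
    (hper : g (2 * π) = g 0) (hB : ∀ s ∈ Set.Icc 0 (2 * π), ‖g s‖ ≤ B) :
    c * ‖∫ s in (0:ℝ)..(2 * π), Complex.exp (Complex.I * c * Real.cos (θ - s)) * g s‖
      ≤ (c * a ^ 2 + 1) * B * (4 * π / a) + (∫ s in (0:ℝ)..(2 * π), ‖g' s‖) / (2 * a) := by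
  have h2π : (0:ℝ) ≤ 2 * π := by positivity
  have hgc : Continuous g := continuous_iff_continuousAt.2 fun s => (hg s).continuousAt
  set E : ℝ → ℂ := fun s => Complex.exp (Complex.I * c * Real.cos (θ - s)) with hE
  set P : ℝ → ℝ := fun s => a ^ 2 + sin (s - θ) ^ 2 with hP
  set h : ℝ → ℝ := fun s => sin (s - θ) / P s with hh
  set h' : ℝ → ℝ := fun s => cos (s - θ) * (a ^ 2 - sin (s - θ) ^ 2) / P s ^ 2 with hh'
  have hPpos : ∀ s, 0 < P s := fun s => by positivity
  have hPc : Continuous P := by fun_prop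
  have hEc : Continuous E := by fun_prop
  have hhc : Continuous h := by
    refine Continuous.div (by fun_prop) hPc fun s => (hPpos s).ne'
  have hhc' : Continuous h' := by
    refine Continuous.div (by fun_prop) (hPc.pow 2) fun s => (pow_pos (hPpos s) 2).ne'
  have hPic : Continuous fun s => 1 / P s :=
    continuous_const.div hPc fun s => (hPpos s).ne'
  have hhd : ∀ s, HasDerivAt h (h' s) s := hasDerivAt_sin_sub_div a ha θ
  have hEd : ∀ s, HasDerivAt E (-(Complex.I * c * sin (s - θ)) * E s) s := by
    intro s
    have h1 : HasDerivAt (fun s => cos (θ - s)) (-sin (s - θ)) s := by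
      have : HasDerivAt (fun s => cos (θ - s)) (-sin (θ - s) * -1) s :=
        ((hasDerivAt_id s).const_sub θ).cos
      convert this using 1
      rw [← neg_sub θ s, sin_neg]
      ring
    convert (h1.ofReal_comp.const_mul (Complex.I * c)).cexp using 1
    simp only [hE]
    push_cast
    ring
  have hEn : ∀ s, ‖E s‖ = 1 := by
    intro s
    have : Complex.I * c * Real.cos (θ - s) = ((c * Real.cos (θ - s) : ℝ) : ℂ) * Complex.I := by
      push_cast; ring
    simp only [hE]
    rw [this, Complex.norm_exp_ofReal_mul_I]
  set w : ℝ → ℂ := fun s => Complex.I * c * (a ^ 2 * (1 / P s : ℝ)) * (g s * E s)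
    + g' s * h s * E s + g s * h' s * E s with hw
  have hwc : Continuous w := by
    have := Complex.continuous_ofReal.comp hhc
    have := Complex.continuous_ofReal.comp hhc'
    have := Complex.continuous_ofReal.comp hPic
    simp only [Function.comp_def] at *
    fun_prop
  have hd : ∀ s ∈ Set.uIcc 0 (2 * π), HasDerivAt (fun s => g s * h s * E s)
      (w s - Complex.I * c * (E s * g s)) s := by
    intro s _
    refine (((hg s).mul (hhd s).ofReal_comp).mul (hEd s)).congr_deriv ?_
    have hp : (P s : ℂ) ≠ 0 := by exact_mod_cast (hPpos s).ne'
    have hs : (h s : ℂ) * sin (s - θ) = 1 - a ^ 2 * (1 / P s : ℝ) := by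
      have : h s * sin (s - θ) = 1 - a ^ 2 * (1 / P s) := by
        have := (hPpos s).ne'
        simp only [hh]
        field_simp
        simp only [hP]
        ring
      exact_mod_cast this
    simp only [hw, Pi.mul_apply]
    linear_combination -Complex.I * c * g s * E s * hs
  have hint := intervalIntegral.integral_eq_sub_of_hasDerivAt hd
    ((hwc.sub (by fun_prop)).intervalIntegrable _ _)
  rw [intervalIntegral.integral_sub (hwc.intervalIntegrable _ _)
    (Continuous.intervalIntegrable (by fun_prop) _ _), intervalIntegral.integral_const_mul] at hint
  have hbd : g (2 * π) * h (2 * π) * E (2 * π) - g 0 * h 0 * E 0 = 0 := by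
    have e1 : h (2 * π) = h 0 := by
      simp only [hh, hP]
      rw [show 2 * π - θ = (0 - θ) + 2 * π by ring, sin_add_two_pi]
    have e2 : E (2 * π) = E 0 := by
      simp only [hE]
      rw [show θ - 2 * π = (θ - 0) - 2 * π by ring, cos_sub_two_pi]
    rw [hper, e1, e2, sub_self]
  rw [hbd, sub_eq_zero] at hint
  have hnorm : c * ‖∫ s in (0:ℝ)..(2 * π), E s * g s‖ = ‖∫ s in (0:ℝ)..(2 * π), w s‖ := by
    rw [hint, norm_mul, norm_mul, Complex.norm_I, one_mul, Complex.norm_real, norm_of_nonneg hc.le]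
  have hB0 : 0 ≤ B := (norm_nonneg _).trans (hB 0 ⟨le_rfl, h2π⟩)
  have hhn : ∀ s, |h s| ≤ 1 / (2 * a) := by
    intro s
    simp only [hh]
    rw [abs_div, abs_of_pos (hPpos s), div_le_div_iff₀ (hPpos s) (by positivity)]
    simp only [hP]
    rw [← sq_abs (sin _)]
    nlinarith [sq_nonneg (a - |sin (s - θ)|)]
  have hhn' : ∀ s, |h' s| ≤ 1 / P s := by
    intro s
    simp only [hh']
    rw [abs_div, abs_mul, abs_of_pos (pow_pos (hPpos s) 2),
      div_le_div_iff₀ (pow_pos (hPpos s) 2) (hPpos s), one_mul, sq (P s)]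
    refine mul_le_mul_of_nonneg_right ?_ (hPpos s).le
    have h1 : |a ^ 2 - sin (s - θ) ^ 2| ≤ P s := by
      simp only [hP]
      rw [abs_le]
      constructor <;> nlinarith [sq_nonneg a, sq_nonneg (sin (s - θ))]
    calc _ ≤ 1 * P s := mul_le_mul (abs_cos_le_one _) h1 (abs_nonneg _) zero_le_one
      _ = P s := one_mul _
  have hwn : ∀ s ∈ Set.Icc 0 (2 * π),
      ‖w s‖ ≤ (c * a ^ 2 + 1) * B * (1 / P s) + ‖g' s‖ * (1 / (2 * a)) := by
    intro s hs
    have hP1 : 0 ≤ 1 / P s := (one_div_pos.2 (hPpos s)).le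
    have n1 : ‖Complex.I * c * (a ^ 2 * (1 / P s : ℝ)) * (g s * E s)‖
        ≤ c * a ^ 2 * (1 / P s) * B := by
      have : ‖Complex.I * c * (a ^ 2 * (1 / P s : ℝ)) * (g s * E s)‖
          = c * a ^ 2 * (1 / P s) * ‖g s‖ := by
        rw [norm_mul, norm_mul, norm_mul, norm_mul, norm_mul, norm_pow, hEn, Complex.norm_I,
          Complex.norm_real, Complex.norm_real, Complex.norm_real, norm_of_nonneg hc.le,
          norm_of_nonneg ha.le, norm_of_nonneg hP1]
        ring
      rw [this]
      exact mul_le_mul_of_nonneg_left (hB s hs) (by positivity)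
    have n2 : ‖g' s * h s * E s‖ ≤ ‖g' s‖ * (1 / (2 * a)) := by
      rw [norm_mul, norm_mul, hEn, mul_one, Complex.norm_real]
      exact mul_le_mul_of_nonneg_left (hhn s) (norm_nonneg _)
    have n3 : ‖g s * h' s * E s‖ ≤ B * (1 / P s) := by
      rw [norm_mul, norm_mul, hEn, mul_one, Complex.norm_real]
      exact mul_le_mul (hB s hs) (hhn' s) (norm_nonneg _) hB0
    calc ‖w s‖ ≤ _ := norm_add₃_le
      _ ≤ _ := add_le_add_three n1 n2 n3
      _ = _ := by ring
  rw [hnorm]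
  calc ‖∫ s in (0:ℝ)..(2 * π), w s‖ ≤ ∫ s in (0:ℝ)..(2 * π), ‖w s‖ :=
        intervalIntegral.norm_integral_le_integral_norm h2π
    _ ≤ ∫ s in (0:ℝ)..(2 * π), ((c * a ^ 2 + 1) * B * (1 / P s) + ‖g' s‖ * (1 / (2 * a))) :=
        intervalIntegral.integral_mono_on h2π (hwc.norm.intervalIntegrable _ _)
          (Continuous.intervalIntegrable (by fun_prop) _ _) hwn
    _ = (c * a ^ 2 + 1) * B * (∫ s in (0:ℝ)..(2 * π), 1 / P s)
          + (∫ s in (0:ℝ)..(2 * π), ‖g' s‖) * (1 / (2 * a)) := by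
        rw [intervalIntegral.integral_add (Continuous.intervalIntegrable (by fun_prop) _ _)
          (Continuous.intervalIntegrable (by fun_prop) _ _),
          intervalIntegral.integral_const_mul, intervalIntegral.integral_mul_const]
    _ ≤ _ := by
        rw [mul_one_div]
        gcongr
        exact integral_inv_sq_add_sin_sq_le a ha θ

lemma norm_le_integral_norm_add_norm_deriv {E : Type*} [NormedAddCommGroup E] [NormedSpace ℝ E]
    [CompleteSpace E] {φ : ℝ → E} (hφ : ContDiff ℝ 1 φ) {T : ℝ}
    (hT : 1 ≤ T) {x : ℝ} (hx : x ∈ Set.Icc 0 T) :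
    ‖φ x‖ ≤ ∫ s in (0:ℝ)..T, (‖φ s‖ + ‖deriv φ s‖) := by
  have hT0 : 0 ≤ T := by linarith
  have hc := hφ.continuous
  have hc' := hφ.continuous_deriv le_rfl
  have hd : ∀ s, HasDerivAt φ (deriv φ s) s := fun s =>
    (hφ.differentiable one_ne_zero s).hasDerivAt
  set A := ∫ s in (0:ℝ)..T, ‖φ s‖
  set D := ∫ s in (0:ℝ)..T, ‖deriv φ s‖
  have hA : 0 ≤ A := intervalIntegral.integral_nonneg hT0 fun s _ => norm_nonneg _
  have hdiff : ∀ y ∈ Set.Icc 0 T, ‖φ x‖ - D ≤ ‖φ y‖ := by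
    intro y hy
    have h1 : φ x - φ y = ∫ s in y..x, deriv φ s :=
      (intervalIntegral.integral_eq_sub_of_hasDerivAt (fun s _ => hd s)
        (hc'.intervalIntegrable _ _)).symm
    have h2 : ‖φ x - φ y‖ ≤ D := by
      rw [h1]
      refine intervalIntegral.norm_integral_le_abs_integral_norm.trans ?_
      refine (intervalIntegral.abs_integral_mono_interval ?_
        (Filter.Eventually.of_forall fun s => norm_nonneg _)
        (hc'.norm.intervalIntegrable _ _)).trans_eq
          (abs_of_nonneg (intervalIntegral.integral_nonneg hT0 fun s _ => norm_nonneg _))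
      rw [Set.uIoc_of_le hT0]
      intro s hs
      rw [Set.mem_uIoc] at hs
      rcases hs with hs | hs
      · exact ⟨hy.1.trans_lt hs.1, hs.2.trans hx.2⟩
      · exact ⟨hx.1.trans_lt hs.1, hs.2.trans hy.2⟩
    have h3 := norm_sub_norm_le (φ x) (φ y)
    linarith
  have hI : T * (‖φ x‖ - D) ≤ A := by
    have := intervalIntegral.integral_mono_on (μ := volume) hT0
      (continuous_const.intervalIntegrable _ _)
      (hc.norm.intervalIntegrable _ _) hdiff
    rw [intervalIntegral.integral_const, smul_eq_mul, sub_zero] at this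
    exact this
  rw [intervalIntegral.integral_add (hc.norm.intervalIntegrable _ _)
    (hc'.norm.intervalIntegrable _ _)]
  change _ ≤ A + D
  by_contra! hlt
  nlinarith

lemma sq_intervalIntegral_le {f : ℝ → ℝ} (hf : Continuous f) {T : ℝ} (hT : 0 < T) :
    (∫ s in (0:ℝ)..T, f s) ^ 2 ≤ T * ∫ s in (0:ℝ)..T, f s ^ 2 := by
  set A := ∫ s in (0:ℝ)..T, f s
  have h : 0 ≤ ∫ s in (0:ℝ)..T, (T * f s - A) ^ 2 :=
    intervalIntegral.integral_nonneg hT.le fun s _ => sq_nonneg _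
  have he : ∫ s in (0:ℝ)..T, (T * f s - A) ^ 2
      = T ^ 2 * (∫ s in (0:ℝ)..T, f s ^ 2) - 2 * T * A * A + T * A ^ 2 := by
    have : ∀ s, (T * f s - A) ^ 2 = T ^ 2 * f s ^ 2 - 2 * T * A * f s + A ^ 2 := fun s => by ring
    simp_rw [this]
    rw [intervalIntegral.integral_add (Continuous.intervalIntegrable (by fun_prop) _ _)
      (Continuous.intervalIntegrable (by fun_prop) _ _),
      intervalIntegral.integral_sub (Continuous.intervalIntegrable (by fun_prop) _ _)
      (Continuous.intervalIntegrable (by fun_prop) _ _),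
      intervalIntegral.integral_const_mul, intervalIntegral.integral_const_mul]
    simp [A]
  rw [he] at h
  have h2 : 0 ≤ T * (T * (∫ s in (0:ℝ)..T, f s ^ 2) - A ^ 2) := by linarith
  have := nonneg_of_mul_nonneg_right h2 hT
  linarith

lemma sq_integral_norm_add_norm_deriv_le {E : Type*} [NormedAddCommGroup E] [NormedSpace ℝ E]
    {φ : ℝ → E} (hφ : ContDiff ℝ 1 φ) {T : ℝ} (hT : 0 < T) :
    (∫ s in (0:ℝ)..T, (‖φ s‖ + ‖deriv φ s‖)) ^ 2
      ≤ 2 * T * ∫ s in (0:ℝ)..T, (‖φ s‖ ^ 2 + ‖deriv φ s‖ ^ 2) := by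
  have hc := hφ.continuous
  have hc' := hφ.continuous_deriv le_rfl
  calc _ ≤ T * ∫ s in (0:ℝ)..T, (‖φ s‖ + ‖deriv φ s‖) ^ 2 :=
        sq_intervalIntegral_le (by fun_prop) hT
    _ ≤ T * ∫ s in (0:ℝ)..T, 2 * (‖φ s‖ ^ 2 + ‖deriv φ s‖ ^ 2) := by
        refine mul_le_mul_of_nonneg_left ?_ hT.le
        refine intervalIntegral.integral_mono_on hT.le
          (Continuous.intervalIntegrable (by fun_prop) _ _)
          (Continuous.intervalIntegrable (by fun_prop) _ _) fun s _ => ?_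
        nlinarith [sq_nonneg (‖φ s‖ - ‖deriv φ s‖)]
    _ = _ := by
        rw [intervalIntegral.integral_const_mul]
        ring

/-- Uniform bound, on a compact square, for a `C¹` function and its second partial derivative. -/
lemma exists_bound_and_hasDerivAt_snd {ℓ : ℝ → ℝ → ℂ}
    (hℓ : ContDiff ℝ 1 (fun p : ℝ × ℝ => ℓ p.1 p.2)) (T : ℝ) :
    ∃ (M : ℝ) (ℓ' : ℝ → ℝ → ℂ), 0 < M ∧ (∀ θ s, HasDerivAt (ℓ θ) (ℓ' θ s) s) ∧
      (∀ θ, Continuous (ℓ' θ)) ∧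
      ∀ θ ∈ Set.Icc 0 T, ∀ s ∈ Set.Icc 0 T, ‖ℓ θ s‖ ≤ M ∧ ‖ℓ' θ s‖ ≤ M := by
  set F : ℝ × ℝ → ℂ := fun p => ℓ p.1 p.2 with hF
  have hF' : Continuous fun p => fderiv ℝ F p (0, 1) :=
    (hℓ.continuous_fderiv one_ne_zero).clm_apply continuous_const
  have hK : IsCompact (Set.Icc (0:ℝ) T ×ˢ Set.Icc (0:ℝ) T) := isCompact_Icc.prod isCompact_Icc
  obtain ⟨M₁, hM₁⟩ := hK.exists_bound_of_continuousOn hℓ.continuous.continuousOn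
  obtain ⟨M₂, hM₂⟩ := hK.exists_bound_of_continuousOn hF'.continuousOn
  refine ⟨max 1 (max M₁ M₂), fun θ s => fderiv ℝ F (θ, s) (0, 1),
    zero_lt_one.trans_le (le_max_left _ _), fun θ s => ?_, fun θ => ?_, fun θ hθ s hs => ?_⟩
  · have h1 : HasDerivAt (fun s : ℝ => (θ, s)) ((0, 1) : ℝ × ℝ) s :=
      (hasDerivAt_const s θ).prodMk (hasDerivAt_id s)
    exact ((hℓ.differentiable one_ne_zero (θ, s)).hasFDerivAt.comp_hasDerivAt s h1 :)
  · exact hF'.comp (by fun_prop : Continuous fun s : ℝ => (θ, s))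
  · exact ⟨(hM₁ (θ, s) ⟨hθ, hs⟩).trans ((le_max_left _ _).trans (le_max_right _ _)),
      (hM₂ (θ, s) ⟨hθ, hs⟩).trans ((le_max_right _ _).trans (le_max_right _ _))⟩

/-- Core `O(R^{-1/2})` decay estimate (`H¹ → L²`) for the oscillatory integral operator with
kernel `e^{2ikR cos(θ-s)} ℓ(θ,s)`: for `C¹` doubly `2π`-periodic `ℓ` there is `C > 0` such
that for all `R ≥ 1` and all `C¹` `2π`-periodic `φ`, the `L²`-norm in `θ` of
`∫_0^{2π} e^{2ikR cos(θ-s)} ℓ(θ,s) φ(s) ds` is at most `C R^{-1/2} ‖φ‖_{H¹}`. -/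
theorem oscillatory_operator_decay_estimate
    (k : ℝ) (hk : 0 < k) (ℓ : ℝ → ℝ → ℂ)
    (hℓ : ContDiff ℝ 1 (fun p : ℝ × ℝ => ℓ p.1 p.2))
    (hℓper1 : ∀ θ s, ℓ (θ + 2 * π) s = ℓ θ s)
    (hℓper2 : ∀ θ s, ℓ θ (s + 2 * π) = ℓ θ s) :
    ∃ C > 0, ∀ R : ℝ, 1 ≤ R →
      ∀ φ : ℝ → ℂ, ContDiff ℝ 1 φ → Function.Periodic φ (2 * π) →
        Real.sqrt (∫ θ in (0:ℝ)..(2 * π),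
            ‖∫ s in (0:ℝ)..(2 * π),
                Complex.exp (2 * Complex.I * k * R * Real.cos (θ - s)) * ℓ θ s * φ s‖ ^ 2)
          ≤ C / Real.sqrt R *
              Real.sqrt (∫ s in (0:ℝ)..(2 * π), (‖φ s‖ ^ 2 + ‖deriv φ s‖ ^ 2)) := by
  obtain ⟨M, ℓ', hM, hd, hc', hbd⟩ := exists_bound_and_hasDerivAt_snd hℓ (2 * π)
  have h2π : (0:ℝ) < 2 * π := by positivity
  set K : ℝ := ((2 * k + 1) * (4 * π) + 1 / 2) * M / (2 * k) with hK
  have hK0 : 0 < K := by positivity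
  refine ⟨K * (2 * (2 * π)), by positivity, fun R hR φ hφ hφper => ?_⟩
  have hR0 : 0 < R := by linarith
  have hsR : 0 < √R := sqrt_pos.2 hR0
  set N : ℝ := ∫ s in (0:ℝ)..(2 * π), (‖φ s‖ + ‖deriv φ s‖)
  set H : ℝ := ∫ s in (0:ℝ)..(2 * π), (‖φ s‖ ^ 2 + ‖deriv φ s‖ ^ 2)
  have hN0 : 0 ≤ N := intervalIntegral.integral_nonneg h2π.le fun s _ => by positivity
  have hNH : N ^ 2 ≤ 2 * (2 * π) * H := sq_integral_norm_add_norm_deriv_le hφ h2π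
  have hφc := hφ.continuous
  have hφc' := hφ.continuous_deriv le_rfl
  have hpt : ∀ θ ∈ Set.Icc 0 (2 * π),
      ‖∫ s in (0:ℝ)..(2 * π),
        Complex.exp (2 * Complex.I * k * R * Real.cos (θ - s)) * ℓ θ s * φ s‖ ≤ K * N / √R := by
    intro θ hθ
    have hℓc : Continuous (ℓ θ) := continuous_iff_continuousAt.2 fun s => (hd θ s).continuousAt
    have hℓc' := hc' θ
    have hg : ∀ s, HasDerivAt (fun s => ℓ θ s * φ s) (ℓ' θ s * φ s + ℓ θ s * deriv φ s) s :=
      fun s => (hd θ s).mul (hφ.differentiable one_ne_zero s).hasDerivAt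
    have hper : ℓ θ (2 * π) * φ (2 * π) = ℓ θ 0 * φ 0 := by
      have h1 := hℓper2 θ 0
      have h2 := hφper 0
      rw [zero_add] at h1 h2
      rw [h1, h2]
    have hB : ∀ s ∈ Set.Icc 0 (2 * π), ‖ℓ θ s * φ s‖ ≤ M * N := by
      intro s hs
      rw [norm_mul]
      exact mul_le_mul (hbd θ hθ s hs).1
        (norm_le_integral_norm_add_norm_deriv hφ (by linarith [pi_gt_three]) hs)
        (norm_nonneg _) hM.le
    have hD : ∫ s in (0:ℝ)..(2 * π), ‖ℓ' θ s * φ s + ℓ θ s * deriv φ s‖ ≤ M * N := by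
      rw [← intervalIntegral.integral_const_mul]
      refine intervalIntegral.integral_mono_on h2π.le
        (Continuous.intervalIntegrable (by fun_prop) _ _)
        (Continuous.intervalIntegrable (by fun_prop) _ _) fun s hs => ?_
      refine (norm_add_le _ _).trans ?_
      rw [norm_mul, norm_mul, mul_add]
      obtain ⟨h1, h2⟩ := hbd θ hθ s hs
      gcongr
    have key := norm_integral_exp_cos_mul_le (2 * k * R) (1 / √R) (by positivity) (by positivity)
      θ (M * N) _ _ hg (by fun_prop) hper hB
    have heq : ∀ s : ℝ, Complex.exp (2 * Complex.I * k * R * Real.cos (θ - s)) * ℓ θ s * φ s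
        = Complex.exp (Complex.I * (2 * k * R : ℝ) * Real.cos (θ - s)) * (ℓ θ s * φ s) := by
      intro s
      rw [mul_assoc]
      congr 2
      push_cast
      ring
    simp_rw [heq]
    set J := ‖∫ s in (0:ℝ)..(2 * π),
      Complex.exp (Complex.I * (2 * k * R : ℝ) * Real.cos (θ - s)) * (ℓ θ s * φ s)‖
    have hRs : √R ^ 2 = R := sq_sqrt hR0.le
    have h1 : 2 * k * R * J ≤ (2 * k + 1) * (M * N) * (4 * π * √R) + M * N * (√R / 2) := by
      calc 2 * k * R * J ≤ _ := key
        _ ≤ (2 * k * R * (1 / √R) ^ 2 + 1) * (M * N) * (4 * π / (1 / √R))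
            + M * N / (2 * (1 / √R)) := by gcongr
        _ = _ := by
          rw [div_pow, hRs]
          field_simp
    rw [le_div_iff₀ hsR]
    have h2 : 2 * k * √R * (J * √R) ≤ 2 * k * √R * (K * N) := by
      calc 2 * k * √R * (J * √R) = 2 * k * R * J := by
            linear_combination 2 * k * J * hRs
        _ ≤ _ := h1
        _ = _ := by
          rw [hK]
          field_simp
    exact le_of_mul_le_mul_left h2 (by positivity)
  have hout : (∫ θ in (0:ℝ)..(2 * π), ‖∫ s in (0:ℝ)..(2 * π),
      Complex.exp (2 * Complex.I * k * R * Real.cos (θ - s)) * ℓ θ s * φ s‖ ^ 2)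
        ≤ (K * N / √R) ^ 2 * (2 * π) := by
    have := intervalIntegral.norm_integral_le_of_norm_le_const (a := 0) (b := 2 * π)
      (C := (K * N / √R) ^ 2) (f := fun θ => ‖∫ s in (0:ℝ)..(2 * π),
      Complex.exp (2 * Complex.I * k * R * Real.cos (θ - s)) * ℓ θ s * φ s‖ ^ 2) ?_
    · rw [sub_zero, abs_of_pos h2π] at this
      exact (le_abs_self _).trans this
    · intro θ hθ
      rw [Set.uIoc_of_le h2π.le] at hθ
      rw [norm_of_nonneg (by positivity)]
      exact pow_le_pow_left₀ (norm_nonneg _) (hpt θ ⟨hθ.1.le, hθ.2⟩) 2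
  refine sqrt_le_iff.2 ⟨by positivity, hout.trans ?_⟩
  have hH0 : 0 ≤ H := intervalIntegral.integral_nonneg h2π.le fun s _ => by positivity
  calc (K * N / √R) ^ 2 * (2 * π) = (K / √R) ^ 2 * (2 * π) * N ^ 2 := by ring
    _ ≤ (K / √R) ^ 2 * (2 * π) * (2 * (2 * π) * H) := by gcongr
    _ ≤ (K / √R) ^ 2 * (2 * (2 * π)) ^ 2 * H := by
        have : 0 ≤ (K / √R) ^ 2 * (2 * π) ^ 2 * H := by positivity
        linarith
    _ = (K * (2 * (2 * π)) / √R * √H) ^ 2 := by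
        rw [mul_pow _ √H, sq_sqrt hH0]
        ring
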